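/- For every λ⊕⊸ proof π and every unordered pair [α,β] of occurrences of atoms of its conclusion sequent, the BDT B(π)[α,β] is free, i.e., no Boolean variable occurs twice on any path from its root to a leaf. -/

import Mathlib

/-- Formulas of the intuitionistic multiplicative-additive calculus λ⊕⊸:
atoms, labeled sums `⊕ₓ`, and linear implication `⊸`. -/
inductive Formula : Type
  | atom : ℕ → Formula
  | oplus : ℕ → Formula → Formula → Formula
  | limp : Formula → Formula → Formula
deriving DecidableEq

namespace Formula

/-- Number of atom occurrences of a formula. -/
def size : Formula → ℕ
  | atom _ => 1
  | oplus _ A B => A.size + B.size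
  | limp A B => A.size + B.size

/-- The list of Boolean-variable labels of the `⊕` occurrences of a formula. -/
def labels : Formula → List ℕ
  | atom _ => []
  | oplus x A B => x :: (A.labels ++ B.labels)
  | limp A B => A.labels ++ B.labels

end Formula

/-- Number of atom occurrences of a context. -/
def csz (Γ : List Formula) : ℕ := (Γ.map Formula.size).sum

/-- All labels of `⊕` occurrences of a sequent `Γ ⊢ C`. -/
def seqLabels (Γ : List Formula) (C : Formula) : List ℕ :=
  (Γ.map Formula.labels).flatten ++ C.labels

/-- Cut-free, η-expanded sequent calculus proofs of λ⊕⊸. -/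
inductive Proof : List Formula → Formula → Type
  | ax (a : ℕ) : Proof [.atom a] (.atom a)
  | limpR {Γ : List Formula} {A B : Formula} :
      Proof (Γ ++ [A]) B → Proof Γ (.limp A B)
  | limpL {Γ Δ : List Formula} {A B C : Formula} :
      Proof Γ A → Proof (B :: Δ) C → Proof (Γ ++ .limp A B :: Δ) C
  | ex (Γ₁ Γ₂ Γ₃ : List Formula) (A B : Formula) {C : Formula} :
      Proof (Γ₁ ++ A :: (Γ₂ ++ B :: Γ₃)) C → Proof (Γ₁ ++ B :: (Γ₂ ++ A :: Γ₃)) C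
  | oplusR1 (x : ℕ) {Γ : List Formula} {A B : Formula} :
      Proof Γ A → Proof Γ (.oplus x A B)
  | oplusR2 (x : ℕ) {Γ : List Formula} {A B : Formula} :
      Proof Γ B → Proof Γ (.oplus x A B)
  | oplusL (x : ℕ) {Γ : List Formula} {A B C : Formula} :
      Proof (Γ ++ [A]) C → Proof (Γ ++ [B]) C → Proof (Γ ++ [.oplus x A B]) C

/-- Atom occurrences of a sequent `Γ ⊢ C` are identified with the positions
`0, 1, 2, …` in the left-to-right flattening of `Γ` followed by `C`.
A slice is a finite set of unordered pairs of such positions. -/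
abbrev Slice := Finset (Sym2 ℕ)

/-- Reindexing the atom occurrences of a slice along a map of positions. -/
def Slice.reindex (f : ℕ → ℕ) (l : Slice) : Slice := l.image (Sym2.map f)

/-- Position reindex for the exchange rule: maps the positions of the layout
`[a-block][p-block][b-block][q-block]rest` to those of `[a-block][q-block][b-block][p-block]rest`. -/
def swapMap (a p b q : ℕ) (i : ℕ) : ℕ :=
  if i < a then i
  else if i < a + p then i + q + b
  else if i < a + p + b then i - p + q
  else if i < a + p + b + q then i - p - b
  else i

/-- The slicing 𝒮(π) of a λ⊕⊸ proof. -/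
def Proof.slicing : {Γ : List Formula} → {C : Formula} → Proof Γ C → Finset Slice
  | _, _, .ax _ => {({s(0, 1)} : Slice)}
  | _, _, .limpR p => p.slicing
  | _, _, @Proof.limpL Γ _ A _ _ p q =>
      Finset.image₂ (fun l m => l ∪ Slice.reindex (fun i => i + (csz Γ + A.size)) m)
        p.slicing q.slicing
  | _, _, @Proof.ex Γ₁ Γ₂ _ A B _ p =>
      p.slicing.image (Slice.reindex (swapMap (csz Γ₁) A.size (csz Γ₂) B.size))
  | _, _, .oplusR1 _ p => p.slicing
  | _, _, @Proof.oplusR2 _ Γ A _ p =>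
      p.slicing.image (Slice.reindex (fun i => if i < csz Γ then i else i + A.size))
  | _, _, @Proof.oplusL _ Γ A B _ p q =>
      p.slicing.image (Slice.reindex (fun i => if i < csz Γ + A.size then i else i + B.size))
      ∪ q.slicing.image (Slice.reindex (fun i => if i < csz Γ then i else i + A.size))

/-- Binary decision trees: leaves labeled `0`/`1` (as `Bool`), inner vertices labeled
by Boolean variables; `node x l r` has left subtree `l` and right subtree `r`. -/
inductive BDT : Type
  | leaf : Bool → BDT
  | node : ℕ → BDT → BDT → BDT
deriving DecidableEq

namespace BDT

/-- Evaluation of a BDT under a valuation: go left when the variable is `false` (0),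
right when it is `true` (1). -/
def eval (v : ℕ → Bool) : BDT → Bool
  | leaf b => b
  | node x l r => if v x then r.eval v else l.eval v

/-- Two BDTs are equivalent when they compute the same Boolean function. -/
def Equiv (φ ψ : BDT) : Prop := ∀ v : ℕ → Bool, φ.eval v = ψ.eval v

/-- Variables occurring in a BDT. -/
def vars : BDT → Finset ℕ
  | leaf _ => ∅
  | node x l r => insert x (l.vars ∪ r.vars)

/-- A BDT is free when no variable occurs twice on a path from the root to a leaf. -/
def Free : BDT → Prop
  | leaf _ => True
  | node x l r => x ∉ l.vars ∧ x ∉ r.vars ∧ l.Free ∧ r.Free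

/-- Negation of a BDT: swap the 0/1 labels at the leaves. -/
def neg : BDT → BDT
  | leaf b => leaf !b
  | node x l r => node x l.neg r.neg

end BDT

/-- The BDT slicing B(π) of a proof, as a function of two atom positions of the
conclusion sequent (it is symmetric in the two positions, and `0` on positions
that do not correspond to a pair of atoms of the sequent). -/
def Proof.bdt : {Γ : List Formula} → {C : Formula} → Proof Γ C → ℕ → ℕ → BDT
  | _, _, .ax _, i, j =>
      if (i = 0 ∧ j = 1) ∨ (i = 1 ∧ j = 0) then .leaf true else .leaf false
  | _, _, .limpR p, i, j => p.bdt i j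
  | _, _, @Proof.limpL Γ _ A _ _ p q, i, j =>
      if i < csz Γ + A.size ∧ j < csz Γ + A.size then p.bdt i j
      else if csz Γ + A.size ≤ i ∧ csz Γ + A.size ≤ j then
        q.bdt (i - (csz Γ + A.size)) (j - (csz Γ + A.size))
      else .leaf false
  | _, _, @Proof.ex Γ₁ Γ₂ _ A B _ p, i, j =>
      p.bdt (swapMap (csz Γ₁) B.size (csz Γ₂) A.size i)
            (swapMap (csz Γ₁) B.size (csz Γ₂) A.size j)
  | _, _, @Proof.oplusR1 _ Γ A _ p, i, j =>
      if i < csz Γ + A.size ∧ j < csz Γ + A.size then p.bdt i j else .leaf false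
  | _, _, @Proof.oplusR2 _ Γ A _ p, i, j =>
      if (i < csz Γ ∨ csz Γ + A.size ≤ i) ∧ (j < csz Γ ∨ csz Γ + A.size ≤ j) then
        p.bdt (if i < csz Γ then i else i - A.size) (if j < csz Γ then j else j - A.size)
      else .leaf false
  | _, _, @Proof.oplusL x Γ A B _ p q, i, j =>
      if ((csz Γ ≤ i ∧ i < csz Γ + A.size) ∧ (csz Γ + A.size ≤ j ∧ j < csz Γ + A.size + B.size)) ∨
         ((csz Γ ≤ j ∧ j < csz Γ + A.size) ∧ (csz Γ + A.size ≤ i ∧ i < csz Γ + A.size + B.size)) then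
        .leaf false
      else if (csz Γ ≤ i ∧ i < csz Γ + A.size) ∨ (csz Γ ≤ j ∧ j < csz Γ + A.size) then
        .node x (p.bdt (if i < csz Γ + A.size then i else i - B.size)
                       (if j < csz Γ + A.size then j else j - B.size)) (.leaf false)
      else if (csz Γ + A.size ≤ i ∧ i < csz Γ + A.size + B.size) ∨
              (csz Γ + A.size ≤ j ∧ j < csz Γ + A.size + B.size) then
        .node x (.leaf false) (q.bdt (if i < csz Γ then i else i - A.size)
                                     (if j < csz Γ then j else j - A.size))
      else
        .node x (p.bdt (if i < csz Γ + A.size then i else i - B.size)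
                       (if j < csz Γ + A.size then j else j - B.size))
                (q.bdt (if i < csz Γ then i else i - A.size)
                       (if j < csz Γ then j else j - A.size))

/-- Smaller element of an unordered pair of positions. -/
def pmin (p : Sym2 ℕ) : ℕ := Sym2.lift ⟨fun a b => min a b, fun a b => min_comm a b⟩ p
/-- Larger element of an unordered pair of positions. -/
def pmax (p : Sym2 ℕ) : ℕ := Sym2.lift ⟨fun a b => max a b, fun a b => max_comm a b⟩ p

/-- The BDT slicing B(π) at an unordered pair of atom positions. -/
def Proof.bdtAt {Γ : List Formula} {C : Formula} (π : Proof Γ C) (p : Sym2 ℕ) : BDT :=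
  π.bdt (pmin p) (pmax p)

/-- The slice obtained by evaluating the BDT slicing of `π` under a valuation `v`:
the set of pairs whose BDT evaluates to `1`. -/
def Proof.vslice {Γ : List Formula} {C : Formula} (π : Proof Γ C) (v : ℕ → Bool) :
    Set (Sym2 ℕ) :=
  {p : Sym2 ℕ | (π.bdtAt p).eval v = true}

/-- The labels of the `⊕†` rules of a proof (its Boolean variables). -/
def Proof.labels : {Γ : List Formula} → {C : Formula} → Proof Γ C → List ℕ
  | _, _, .ax _ => []
  | _, _, .limpR p => p.labels
  | _, _, .limpL p q => p.labels ++ q.labels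
  | _, _, .ex _ _ _ _ _ p => p.labels
  | _, _, .oplusR1 _ p => p.labels
  | _, _, .oplusR2 _ p => p.labels
  | _, _, .oplusL x p q => x :: (p.labels ++ q.labels)

/-- Number of rule occurrences of a proof. -/
def Proof.size : {Γ : List Formula} → {C : Formula} → Proof Γ C → ℕ
  | _, _, .ax _ => 1
  | _, _, .limpR p => p.size + 1
  | _, _, .limpL p q => p.size + q.size + 1
  | _, _, .ex _ _ _ _ _ p => p.size + 1
  | _, _, .oplusR1 _ p => p.size + 1
  | _, _, .oplusR2 _ p => p.size + 1
  | _, _, .oplusL x p q => p.size + q.size + 1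

/-- The Boolean variables of the BDT slicing of a proof are labels of its conclusion. -/
theorem Proof.mem_seqLabels_of_mem_vars_bdt {Γ : List Formula} {C : Formula} (π : Proof Γ C)
    (i j y : ℕ) (hy : y ∈ (π.bdt i j).vars) : y ∈ seqLabels Γ C := by
  induction π generalizing i j with
  | ax a =>
    rw [Proof.bdt] at hy
    split_ifs at hy <;> simp [BDT.vars] at hy
  | limpR p ihp =>
    have := ihp _ _ hy
    simp only [seqLabels, Formula.labels, List.map_append, List.flatten_append, List.map_cons,
      List.map_nil, List.flatten_cons, List.flatten_nil, List.mem_append] at this ⊢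
    tauto
  | ex Γ₁ Γ₂ Γ₃ A B p ihp =>
    have := ihp _ _ hy
    simp only [seqLabels, List.map_append, List.flatten_append, List.map_cons,
      List.flatten_cons, List.mem_append] at this ⊢
    tauto
  | limpL p q ihp ihq =>
    rw [Proof.bdt] at hy
    simp only [seqLabels, Formula.labels, List.map_append, List.flatten_append, List.map_cons,
      List.flatten_cons, List.mem_append] at ihp ihq ⊢
    split_ifs at hy
    · have := ihp _ _ hy
      tauto
    · have := ihq _ _ hy
      tauto
    · simp [BDT.vars] at hy
  | oplusR1 x p ihp =>
    rw [Proof.bdt] at hy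
    simp only [seqLabels, Formula.labels, List.mem_append, List.mem_cons] at ihp ⊢
    split_ifs at hy
    · have := ihp _ _ hy
      tauto
    · simp [BDT.vars] at hy
  | oplusR2 x p ihp =>
    rw [Proof.bdt] at hy
    simp only [seqLabels, Formula.labels, List.mem_append, List.mem_cons] at ihp ⊢
    split_ifs at hy
    all_goals first
      | (have := ihp _ _ hy; tauto)
      | simp [BDT.vars] at hy
  | @oplusL x Γ A B C p q ihp ihq =>
    have hp : ∀ i j, y ∈ (p.bdt i j).vars → y ∈ seqLabels (Γ ++ [.oplus x A B]) C := by
      intro i j h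
      have := ihp _ _ h
      simp only [seqLabels, Formula.labels, List.map_append, List.flatten_append, List.map_cons,
        List.map_nil, List.flatten_cons, List.flatten_nil, List.mem_append, List.mem_cons]
        at this ⊢
      tauto
    have hq : ∀ i j, y ∈ (q.bdt i j).vars → y ∈ seqLabels (Γ ++ [.oplus x A B]) C := by
      intro i j h
      have := ihq _ _ h
      simp only [seqLabels, Formula.labels, List.map_append, List.flatten_append, List.map_cons,
        List.map_nil, List.flatten_cons, List.flatten_nil, List.mem_append, List.mem_cons]
        at this ⊢
      tauto
    have hx : x ∈ seqLabels (Γ ++ [.oplus x A B]) C := by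
      simp [seqLabels, Formula.labels]
    have hnode : ∀ l r : BDT, y ∈ (BDT.node x l r).vars →
        y = x ∨ y ∈ l.vars ∨ y ∈ r.vars := by
      intro l r h
      simpa [BDT.vars] using h
    have hleaf : ∀ b, y ∉ (BDT.leaf b).vars := by simp [BDT.vars]
    rw [Proof.bdt] at hy
    generalize csz Γ = g at hy
    split at hy
    · exact absurd hy (hleaf _)
    · split at hy
      · rcases hnode _ _ hy with rfl | h | h
        exacts [hx, hp _ _ h, absurd h (hleaf _)]
      · split at hy
        · rcases hnode _ _ hy with rfl | h | h
          exacts [hx, absurd h (hleaf _), hq _ _ h]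
        · rcases hnode _ _ hy with rfl | h | h
          exacts [hx, hp _ _ h, hq _ _ h]

/-- The BDT slicing of a proof of a sequent with distinct labels consists of free BDTs. -/
theorem Proof.bdt_free {Γ : List Formula} {C : Formula} (π : Proof Γ C)
    (hlab : (seqLabels Γ C).Nodup) (i j : ℕ) : (π.bdt i j).Free := by
  induction π generalizing i j with
  | ax a =>
    rw [Proof.bdt]
    split_ifs <;> trivial
  | limpR p ihp =>
    exact ihp (by simpa [seqLabels, Formula.labels, List.append_assoc] using hlab) _ _
  | ex Γ₁ Γ₂ Γ₃ A B p ihp =>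
    refine ihp ?_ _ _
    rw [List.nodup_iff_count_le_one] at hlab ⊢
    intro a
    have := hlab a
    simp only [seqLabels, List.map_append, List.flatten_append, List.map_cons,
      List.flatten_cons, List.count_append] at this ⊢
    omega
  | limpL p q ihp ihq =>
    rw [List.nodup_iff_count_le_one] at hlab ihp ihq
    simp only [seqLabels, Formula.labels, List.map_append, List.flatten_append, List.map_cons,
      List.flatten_cons, List.count_append] at hlab ihp ihq
    rw [Proof.bdt]
    split_ifs
    · exact ihp (fun a => by have := hlab a; omega) _ _
    · exact ihq (fun a => by have := hlab a; omega) _ _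
    · trivial
  | oplusR1 x p ihp =>
    rw [List.nodup_iff_count_le_one] at hlab ihp
    simp only [seqLabels, Formula.labels, List.count_append, List.count_cons] at hlab ihp
    rw [Proof.bdt]
    split_ifs
    · exact ihp (fun a => by have := hlab a; omega) _ _
    · trivial
  | oplusR2 x p ihp =>
    rw [List.nodup_iff_count_le_one] at hlab ihp
    simp only [seqLabels, Formula.labels, List.count_append, List.count_cons] at hlab ihp
    rw [Proof.bdt]
    split
    · exact ihp (fun a => by have := hlab a; omega) _ _
    · trivial
  | @oplusL x Γ A B C p q ihp ihq =>
    have hxp : ∀ i j, x ∉ (p.bdt i j).vars := by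
      intro i j h
      have := p.mem_seqLabels_of_mem_vars_bdt i j x h
      rw [← List.one_le_count_iff] at this
      have hc := List.nodup_iff_count_le_one.1 hlab x
      simp [seqLabels, Formula.labels] at this hc
      omega
    have hxq : ∀ i j, x ∉ (q.bdt i j).vars := by
      intro i j h
      have := q.mem_seqLabels_of_mem_vars_bdt i j x h
      rw [← List.one_le_count_iff] at this
      have hc := List.nodup_iff_count_le_one.1 hlab x
      simp [seqLabels, Formula.labels] at this hc
      omega
    have hp := ihp (by
      rw [List.nodup_iff_count_le_one] at hlab ⊢
      intro a
      have := hlab a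
      simp only [seqLabels, Formula.labels, List.map_append, List.flatten_append, List.map_cons,
        List.map_nil, List.flatten_cons, List.flatten_nil, List.count_append, List.count_cons]
        at this ⊢
      omega)
    have hq := ihq (by
      rw [List.nodup_iff_count_le_one] at hlab ⊢
      intro a
      have := hlab a
      simp only [seqLabels, Formula.labels, List.map_append, List.flatten_append, List.map_cons,
        List.map_nil, List.flatten_cons, List.flatten_nil, List.count_append, List.count_cons]
        at this ⊢
      omega)
    have hleaf : ∀ b, x ∉ (BDT.leaf b).vars := by simp [BDT.vars]
    rw [Proof.bdt]
    split
    · trivial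
    · split
      · exact ⟨hxp _ _, hleaf _, hp _ _, trivial⟩
      · split
        · exact ⟨hleaf _, hxq _ _, trivial, hq _ _⟩
        · exact ⟨hxp _ _, hxq _ _, hp _ _, hq _ _⟩

/-- For every λ⊕⊸ proof `π` of a sequent `Γ ⊢ C` whose `⊕` occurrences carry distinct
labels, and every unordered pair of atom positions of the conclusion, the BDT
`B(π)[α,β]` is free: no Boolean variable occurs twice on a path from its root to a leaf. -/
theorem bdt_slicing_free
    (Γ : List Formula) (C : Formula) (hlab : (seqLabels Γ C).Nodup)
    (π : Proof Γ C) (p : Sym2 ℕ) :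
    (π.bdtAt p).Free := by
  exact π.bdt_free hlab _ _
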